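/- (Main theorem: convergence of AdaLVR with AdaGrad-Norm and SAGA estimator.) In the AdaLVR-SAGA setup, the averaged iterate x̄_T = (1/T) ∑_{t=1}^T x^(t) satisfies E[ f(x̄_T) ] − f(x*) ≤ ( (η + D²/(2η)) √(4 L n Δ₁) + 8 L (η + D²/(2η))² ) / T, where Δ₁ = f(x^(1)) − f(x*). -/

import Mathlib

/-- State of the AdaLVR-SAGA algorithm after `t` steps, driven by the index sequence `idx`
(where the index used at step `t ≥ 1` is `idx t`).  The state at time `t` is the triple
`(x^{(t+1)}, ỹ^{(t)}, G_t)` where `G_t = ∑_{s=1}^t ‖g^{(s)}‖²` (so `A_t = √G_t`),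
with initial state `(x^{(1)}, ỹ^{(0)}, 0)`. -/
noncomputable def adaLVRstate (n d : ℕ) (f : Fin n → EuclideanSpace ℝ (Fin d) → ℝ)
    (proj : EuclideanSpace ℝ (Fin d) → EuclideanSpace ℝ (Fin d))
    (η : ℝ) (x1 : EuclideanSpace ℝ (Fin d)) (idx : ℕ → Fin n) :
    ℕ → EuclideanSpace ℝ (Fin d) × (Fin n → EuclideanSpace ℝ (Fin d)) × ℝ
  | 0 => (x1, fun _ => x1, 0)
  | (t + 1) =>
      let s := adaLVRstate n d f proj η x1 idx t
      let i := idx (t + 1)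
      let g := gradient (f i) s.1 - gradient (f i) (s.2.1 i)
        + (n : ℝ)⁻¹ • ∑ j, gradient (f j) (s.2.1 j)
      let G := s.2.2 + ‖g‖ ^ 2
      (proj (s.1 - (η / Real.sqrt G) • g), Function.update s.2.1 i s.1, G)

/-- The iterate `x^{(t)}` of AdaLVR-SAGA, for `t ≥ 1`. -/
noncomputable def adaLVRx (n d : ℕ) (f : Fin n → EuclideanSpace ℝ (Fin d) → ℝ)
    (proj : EuclideanSpace ℝ (Fin d) → EuclideanSpace ℝ (Fin d))
    (η : ℝ) (x1 : EuclideanSpace ℝ (Fin d)) (idx : ℕ → Fin n) (t : ℕ) :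
    EuclideanSpace ℝ (Fin d) :=
  (adaLVRstate n d f proj η x1 idx (t - 1)).1

/-- The SAGA gradient estimator `g^{(t)}` of AdaLVR-SAGA, for `t ≥ 1`. -/
noncomputable def adaLVRg (n d : ℕ) (f : Fin n → EuclideanSpace ℝ (Fin d) → ℝ)
    (proj : EuclideanSpace ℝ (Fin d) → EuclideanSpace ℝ (Fin d))
    (η : ℝ) (x1 : EuclideanSpace ℝ (Fin d)) (idx : ℕ → Fin n) (t : ℕ) :
    EuclideanSpace ℝ (Fin d) :=
  let s := adaLVRstate n d f proj η x1 idx (t - 1)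
  let i := idx t
  gradient (f i) s.1 - gradient (f i) (s.2.1 i)
    + (n : ℝ)⁻¹ • ∑ j, gradient (f j) (s.2.1 j)

/-- Extension of a finite index tuple `ω : Fin T → Fin n` to `ℕ`, so that the index used at
step `t ∈ {1, …, T}` is `ω (t - 1)`. -/
def extIdx {n : ℕ} (T : ℕ) (hT : 0 < T) (ω : Fin T → Fin n) : ℕ → Fin n :=
  fun t => ω ⟨(t - 1) % T, Nat.mod_lt _ hT⟩


open scoped Gradient RealInnerProductSpace

section ConvexSmooth

variable {E : Type*} [NormedAddCommGroup E] [InnerProductSpace ℝ E] [CompleteSpace E]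

theorem hasDerivAt_comp_add_smul {f : E → ℝ} (hf : Differentiable ℝ f) (x v : E) (t : ℝ) :
    HasDerivAt (fun s : ℝ => f (x + s • v)) ⟪∇ f (x + t • v), v⟫ t := by
  have hline : HasDerivAt (fun s : ℝ => x + s • v) v t := by
    simpa using ((hasDerivAt_id t).smul_const v).const_add x
  exact (hf (x + t • v)).hasGradientAt.hasFDerivAt.comp_hasDerivAt t hline

/-- First-order characterization of convexity. -/
theorem ConvexOn.add_inner_gradient_le {f : E → ℝ} (hc : ConvexOn ℝ Set.univ f)
    (hf : Differentiable ℝ f) (x y : E) : f x + ⟪∇ f x, y - x⟫ ≤ f y := by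
  have hline : ConvexOn ℝ Set.univ (fun s : ℝ => f (x + s • (y - x))) := by
    have := hc.comp_affineMap (AffineMap.lineMap x y : ℝ →ᵃ[ℝ] E)
    simpa [Function.comp_def, AffineMap.lineMap_apply, add_comm] using this
  have hd := hasDerivAt_comp_add_smul hf x (y - x) 0
  have := hline.le_slope_of_hasDerivAt (Set.mem_univ 0) (Set.mem_univ 1) one_pos hd
  simp only [slope_def_field, zero_smul, add_zero, one_smul, add_sub_cancel, sub_zero,
    div_one] at this
  linarith

/-- The descent lemma for functions with Lipschitz gradient. -/
theorem le_add_inner_gradient_add_norm_sq {f : E → ℝ} (hf : Differentiable ℝ f) {L : ℝ}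
    (hL : ∀ x y, ‖∇ f x - ∇ f y‖ ≤ L * ‖x - y‖) (x y : E) :
    f y ≤ f x + ⟪∇ f x, y - x⟫ + L / 2 * ‖y - x‖ ^ 2 := by
  set v := y - x with hv
  have hd := hasDerivAt_comp_add_smul hf x v
  have hB : ∀ t : ℝ, HasDerivAt
      (fun s : ℝ => f x + s * ⟪∇ f x, v⟫ + L / 2 * ‖v‖ ^ 2 * s ^ 2)
      (⟪∇ f x, v⟫ + L * ‖v‖ ^ 2 * t) t := by
    intro t
    refine HasDerivAt.congr_deriv ((((hasDerivAt_id t).mul_const ⟪∇ f x, v⟫).const_add (f x)).add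
      (((hasDerivAt_id t).pow 2).const_mul (L / 2 * ‖v‖ ^ 2))) ?_
    simp only [Nat.cast_ofNat, id_eq, Nat.add_one_sub_one, pow_one, mul_one, one_mul]
    ring
  have key := image_le_of_deriv_right_le_deriv_boundary (a := 0) (b := 1)
    (fun t _ => (hd t).continuousAt.continuousWithinAt)
    (fun t _ => (hd t).hasDerivWithinAt) (by simp)
    (fun t _ => (hB t).continuousAt.continuousWithinAt)
    (fun t _ => (hB t).hasDerivWithinAt)
    (fun t ht => by
      have h1 : ⟪∇ f (x + t • v) - ∇ f x, v⟫ ≤ L * (t * ‖v‖) * ‖v‖ := by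
        refine (real_inner_le_norm _ _).trans ?_
        gcongr
        simpa [norm_smul, abs_of_nonneg ht.1] using hL (x + t • v) x
      rw [inner_sub_left] at h1
      linarith)
    (Set.right_mem_Icc.2 zero_le_one)
  simp only [one_smul, one_mul, one_pow, mul_one, hv, add_sub_cancel] at key
  exact key

/-- Co-coercivity of the gradient of a convex function with Lipschitz gradient. -/
theorem ConvexOn.norm_gradient_sub_sq_le {f : E → ℝ} (hc : ConvexOn ℝ Set.univ f)
    (hf : Differentiable ℝ f) {L : ℝ} (hL0 : 0 < L)
    (hL : ∀ x y, ‖∇ f x - ∇ f y‖ ≤ L * ‖x - y‖) (x z : E) :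
    ‖∇ f x - ∇ f z‖ ^ 2 ≤ 2 * L * (f x - f z - ⟪∇ f z, x - z⟫) := by
  set u := ∇ f x - ∇ f z with hu
  have h1 := hc.add_inner_gradient_le hf z (x - L⁻¹ • u)
  have h2 := le_add_inner_gradient_add_norm_sq hf hL x (x - L⁻¹ • u)
  have e1 : x - L⁻¹ • u - z = (x - z) - L⁻¹ • u := by abel
  have e2 : x - L⁻¹ • u - x = -(L⁻¹ • u) := by abel
  rw [e1, inner_sub_right, inner_smul_right] at h1
  rw [e2, inner_neg_right, inner_smul_right, norm_neg, norm_smul, Real.norm_eq_abs,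
    abs_of_pos (inv_pos.2 hL0)] at h2
  have h3 : ⟪∇ f x, u⟫ - ⟪∇ f z, u⟫ = ‖u‖ ^ 2 := by
    rw [← inner_sub_left, ← hu, real_inner_self_eq_norm_sq]
  have h4 : L⁻¹ * ⟪∇ f x, u⟫ - L⁻¹ * ⟪∇ f z, u⟫ = L⁻¹ * ‖u‖ ^ 2 := by rw [← mul_sub, h3]
  have h5 : L / 2 * (L⁻¹ * ‖u‖) ^ 2 = L⁻¹ * ‖u‖ ^ 2 / 2 := by field_simp
  have h6 : L⁻¹ * ‖u‖ ^ 2 ≤ 2 * (f x - f z - ⟪∇ f z, x - z⟫) := by linarith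
  calc ‖u‖ ^ 2 = L * (L⁻¹ * ‖u‖ ^ 2) := by field_simp
    _ ≤ L * (2 * (f x - f z - ⟪∇ f z, x - z⟫)) := by gcongr
    _ = _ := by ring

end ConvexSmooth

/-- The projection onto a convex set does not increase the distance to its points. -/
theorem norm_proj_sub_sq_le {E : Type*} [NormedAddCommGroup E]
    [InnerProductSpace ℝ E] {X : Set E} (hX : Convex ℝ X) {z p : E} (hp : p ∈ X)
    (hmin : ∀ y ∈ X, ‖p - z‖ ≤ ‖y - z‖) {y : E} (hy : y ∈ X) :
    ‖p - y‖ ^ 2 ≤ ‖z - y‖ ^ 2 := by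
  have : Nonempty X := ⟨⟨p, hp⟩⟩
  have hinf : ‖z - p‖ = ⨅ w : X, ‖z - w‖ := by
    refine le_antisymm (le_ciInf fun w => ?_)
      (ciInf_le ⟨0, by rintro _ ⟨w, rfl⟩; exact norm_nonneg _⟩ (⟨p, hp⟩ : X))
    rw [norm_sub_rev z p, norm_sub_rev z w]
    exact hmin w w.2
  have h := (norm_eq_iInf_iff_real_inner_le_zero hX hp).1 hinf y hy
  have e : z - y = (z - p) - (y - p) := by abel
  rw [e, norm_sub_sq_real (z - p), norm_sub_rev p y]
  nlinarith [sq_nonneg ‖z - p‖]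

theorem sum_norm_sub_mean_sq_le {E : Type*} [NormedAddCommGroup E] [InnerProductSpace ℝ E]
    {n : ℕ} (b : Fin n → E) :
    ∑ i, ‖b i - (n : ℝ)⁻¹ • ∑ j, b j‖ ^ 2 ≤ ∑ i, ‖b i‖ ^ 2 := by
  rcases Nat.eq_zero_or_pos n with rfl | hn
  · simp
  have hn' : (n : ℝ) ≠ 0 := by positivity
  set m := (n : ℝ)⁻¹ • ∑ j, b j with hm
  have hsum : ∑ j, b j = (n : ℝ) • m := by rw [hm, smul_inv_smul₀ hn']
  have h : ∑ i, ‖b i - m‖ ^ 2 = ∑ i, ‖b i‖ ^ 2 - n * ‖m‖ ^ 2 := by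
    simp_rw [norm_sub_sq_real, Finset.sum_add_distrib, Finset.sum_sub_distrib,
      ← Finset.mul_sum, ← sum_inner, hsum, inner_smul_left, real_inner_self_eq_norm_sq]
    simp
    ring
  rw [h]
  have : 0 ≤ (n : ℝ) * ‖m‖ ^ 2 := by positivity
  linarith

/-- Resampling one coordinate of a uniform tuple does not change its law. -/
theorem sum_sum_update {T n : ℕ} (k : Fin T) (φ : (Fin T → Fin n) → ℝ) :
    ∑ ω : Fin T → Fin n, ∑ j, φ (Function.update ω k j) = n * ∑ ω, φ ω := by
  have hswap : Function.Involutive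
      (fun p : (Fin T → Fin n) × Fin n => (Function.update p.1 k p.2, p.1 k)) := by
    rintro ⟨ω, j⟩
    simp
  rw [← Fintype.sum_prod_type' (f := fun ω j => φ (Function.update ω k j)),
    ← Equiv.sum_comp hswap.toPerm, Fintype.sum_prod_type]
  simp [Finset.mul_sum]

/-- One step of projected AdaGrad-Norm with accumulated squared norm `G`. -/
theorem adaGradNorm_step {E : Type*} [NormedAddCommGroup E] [InnerProductSpace ℝ E]
    {X : Set E} (hX : Convex ℝ X) {η D G : ℝ} (hη : 0 < η) (hG : 0 ≤ G) {x p g y : E}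
    (hy : y ∈ X) (hxy : ‖x - y‖ ≤ D) (hp : p ∈ X)
    (hmin : ∀ w ∈ X, ‖p - (x - (η / √(G + ‖g‖ ^ 2)) • g)‖
      ≤ ‖w - (x - (η / √(G + ‖g‖ ^ 2)) • g)‖) :
    ⟪g, x - y⟫ + √(G + ‖g‖ ^ 2) / (2 * η) * ‖p - y‖ ^ 2
      ≤ √G / (2 * η) * ‖x - y‖ ^ 2 + (η + D ^ 2 / (2 * η)) * (√(G + ‖g‖ ^ 2) - √G) := by
  have hproj := norm_proj_sub_sq_le hX hp hmin hy
  have hB2 : √(G + ‖g‖ ^ 2) ^ 2 = G + ‖g‖ ^ 2 := Real.sq_sqrt (by positivity)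
  have hA2 : √G ^ 2 = G := Real.sq_sqrt hG
  have hAB : √G ≤ √(G + ‖g‖ ^ 2) := Real.sqrt_le_sqrt (by nlinarith [sq_nonneg ‖g‖])
  have hA0 : 0 ≤ √G := Real.sqrt_nonneg _
  set B := √(G + ‖g‖ ^ 2)
  set A := √G
  rcases (hA0.trans hAB).eq_or_lt with hB | hB
  · have hAz : A = 0 := le_antisymm (hB ▸ hAB) hA0
    have hg : ‖g‖ ^ 2 = 0 := by
      rw [← hB] at hB2
      nlinarith [sq_nonneg ‖g‖]
    have hg0 : g = 0 := by simpa using hg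
    rw [← hB, hAz, hg0]
    simp
  have e : x - (η / B) • g - y = (x - y) - (η / B) • g := by abel
  rw [e, norm_sub_sq_real (x - y), inner_smul_right, norm_smul, Real.norm_eq_abs,
    abs_of_pos (by positivity), real_inner_comm] at hproj
  have hD : ‖x - y‖ ^ 2 ≤ D ^ 2 := by gcongr
  have h1 : B / (2 * η) * ‖p - y‖ ^ 2
      ≤ B / (2 * η) * ‖x - y‖ ^ 2 - ⟪g, x - y⟫ + η * (‖g‖ ^ 2 / (2 * B)) := by
    calc B / (2 * η) * ‖p - y‖ ^ 2
        ≤ B / (2 * η) * (‖x - y‖ ^ 2 - 2 * (η / B * ⟪g, x - y⟫) + (η / B * ‖g‖) ^ 2) := by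
          gcongr
      _ = _ := by field_simp
  have h2 : ‖g‖ ^ 2 / (2 * B) ≤ B - A := by
    rw [div_le_iff₀ (by positivity)]
    nlinarith
  have h3 : (B - A) / (2 * η) * ‖x - y‖ ^ 2 ≤ (B - A) / (2 * η) * D ^ 2 := by
    have : 0 ≤ B - A := by linarith
    gcongr
  have h4 : η * (‖g‖ ^ 2 / (2 * B)) ≤ η * (B - A) := by gcongr
  have e3 : (B - A) / (2 * η) * ‖x - y‖ ^ 2
      = B / (2 * η) * ‖x - y‖ ^ 2 - A / (2 * η) * ‖x - y‖ ^ 2 := by ring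
  have e4 : (η + D ^ 2 / (2 * η)) * (B - A) = η * (B - A) + (B - A) / (2 * η) * D ^ 2 := by ring
  linarith

section SAGA

variable {E : Type*} [NormedAddCommGroup E] [InnerProductSpace ℝ E] [CompleteSpace E] {n : ℕ}

/-- The SAGA estimator at the point `x` with memory `y`, sampling the index `i`. -/
noncomputable def sagaEstimator (f : Fin n → E → ℝ) (x : E) (y : Fin n → E) (i : Fin n) : E :=
  ∇ (f i) x - ∇ (f i) (y i) + (n : ℝ)⁻¹ • ∑ j, ∇ (f j) (y j)

/-- The sum of the Bregman divergences of the `f i` between the memory `y i` and `z`. -/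
noncomputable def sumBregman (f : Fin n → E → ℝ) (z : E) (y : Fin n → E) : ℝ :=
  ∑ i, (f i (y i) - f i z - ⟪∇ (f i) z, y i - z⟫)

theorem sumBregman_nonneg {f : Fin n → E → ℝ} (hc : ∀ i, ConvexOn ℝ Set.univ (f i))
    (hf : ∀ i, Differentiable ℝ (f i)) (z : E) (y : Fin n → E) : 0 ≤ sumBregman f z y :=
  Finset.sum_nonneg fun i _ => by
    linarith [(hc i).add_inner_gradient_le (hf i) z (y i)]

theorem sumBregman_const {f : Fin n → E → ℝ} {z : E} (hz : ∑ i, ∇ (f i) z = 0) (x : E) :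
    sumBregman f z (fun _ => x) = ∑ i, f i x - ∑ i, f i z := by
  simp only [sumBregman, Finset.sum_sub_distrib, ← sum_inner, hz, inner_zero_left, sub_zero]

theorem sum_sumBregman_update (f : Fin n → E → ℝ) (z x : E) (y : Fin n → E) :
    ∑ j, sumBregman f z (Function.update y j x)
      = (n - 1) * sumBregman f z y + sumBregman f z (fun _ => x) := by
  have h : ∀ j, sumBregman f z (Function.update y j x) = sumBregman f z y
      - (f j (y j) - f j z - ⟪∇ (f j) z, y j - z⟫)
      + (f j x - f j z - ⟪∇ (f j) z, x - z⟫) := by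
    intro j
    simp only [sumBregman]
    rw [← Finset.add_sum_erase _ _ (Finset.mem_univ j),
      ← Finset.add_sum_erase (a := j) Finset.univ
        (fun i => f i (y i) - f i z - ⟪∇ (f i) z, y i - z⟫) (Finset.mem_univ j)]
    have : ∀ i ∈ Finset.univ.erase j, Function.update y j x i = y i := fun i hi =>
      Function.update_of_ne (Finset.ne_of_mem_erase hi) _ _
    rw [Finset.sum_congr rfl fun i hi => by rw [this i hi], Function.update_self]
    ring
  simp_rw [h, Finset.sum_add_distrib, Finset.sum_sub_distrib (G := ℝ) (f := fun _ => sumBregman f z y)]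
  simp only [Finset.sum_const, Finset.card_univ, Fintype.card_fin, nsmul_eq_mul, sumBregman]
  ring

/-- The SAGA estimator is unbiased. -/
theorem sum_sagaEstimator (hn : n ≠ 0) (f : Fin n → E → ℝ) (x : E) (y : Fin n → E) :
    ∑ i, sagaEstimator f x y i = ∑ i, ∇ (f i) x := by
  have : (n : ℝ) ≠ 0 := by exact_mod_cast hn
  simp only [sagaEstimator, Finset.sum_add_distrib, Finset.sum_sub_distrib, Finset.sum_const,
    Finset.card_univ, Fintype.card_fin, ← Nat.cast_smul_eq_nsmul ℝ, smul_inv_smul₀ this,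
    sub_add_cancel]

theorem sum_norm_sagaEstimator_sq_le {f : Fin n → E → ℝ}
    (hc : ∀ i, ConvexOn ℝ Set.univ (f i)) (hf : ∀ i, Differentiable ℝ (f i)) {L : ℝ}
    (hL0 : 0 < L) (hL : ∀ i x y, ‖∇ (f i) x - ∇ (f i) y‖ ≤ L * ‖x - y‖) {z : E}
    (hz : ∑ i, ∇ (f i) z = 0) (x : E) (y : Fin n → E) :
    ∑ i, ‖sagaEstimator f x y i‖ ^ 2
      ≤ 4 * L * sumBregman f z (fun _ => x) + 4 * L * sumBregman f z y := by
  set b : Fin n → E := fun i => ∇ (f i) (y i) - ∇ (f i) z with hb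
  have hmean : ∑ j, ∇ (f j) (y j) = ∑ j, b j := by
    simp [hb, Finset.sum_sub_distrib, hz]
  have hterm : ∀ i, ‖sagaEstimator f x y i‖ ^ 2
      ≤ 2 * ‖∇ (f i) x - ∇ (f i) z‖ ^ 2 + 2 * ‖b i - (n : ℝ)⁻¹ • ∑ j, b j‖ ^ 2 := by
    intro i
    have e : sagaEstimator f x y i
        = (∇ (f i) x - ∇ (f i) z) - (b i - (n : ℝ)⁻¹ • ∑ j, b j) := by
      rw [sagaEstimator, hmean]
      simp only [hb]
      abel
    rw [e]
    have := parallelogram_law_with_norm ℝ (∇ (f i) x - ∇ (f i) z) (b i - (n : ℝ)⁻¹ • ∑ j, b j)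
    nlinarith [sq_nonneg ‖(∇ (f i) x - ∇ (f i) z) + (b i - (n : ℝ)⁻¹ • ∑ j, b j)‖]
  have hco : ∀ i w, ‖∇ (f i) w - ∇ (f i) z‖ ^ 2
      ≤ 2 * L * (f i w - f i z - ⟪∇ (f i) z, w - z⟫) := fun i w =>
    (hc i).norm_gradient_sub_sq_le (hf i) hL0 (hL i) w z
  calc ∑ i, ‖sagaEstimator f x y i‖ ^ 2
      ≤ ∑ i, (2 * ‖∇ (f i) x - ∇ (f i) z‖ ^ 2 + 2 * ‖b i - (n : ℝ)⁻¹ • ∑ j, b j‖ ^ 2) :=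
        Finset.sum_le_sum fun i _ => hterm i
    _ = 2 * ∑ i, ‖∇ (f i) x - ∇ (f i) z‖ ^ 2
        + 2 * ∑ i, ‖b i - (n : ℝ)⁻¹ • ∑ j, b j‖ ^ 2 := by
        rw [Finset.sum_add_distrib, Finset.mul_sum, Finset.mul_sum]
    _ ≤ 2 * ∑ i, 2 * L * (f i x - f i z - ⟪∇ (f i) z, x - z⟫)
        + 2 * ∑ i, 2 * L * (f i (y i) - f i z - ⟪∇ (f i) z, y i - z⟫) := by
        refine add_le_add (mul_le_mul_of_nonneg_left ?_ two_pos.le)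
          (mul_le_mul_of_nonneg_left ?_ two_pos.le)
        · exact Finset.sum_le_sum fun i _ => hco i x
        · exact (sum_norm_sub_mean_sq_le b).trans (Finset.sum_le_sum fun i _ => hco i (y i))
    _ = _ := by
        simp only [sumBregman, ← Finset.mul_sum]
        ring

theorem sumBregman_const_le_inner {f : Fin n → E → ℝ} (hn : n ≠ 0)
    (hc : ∀ i, ConvexOn ℝ Set.univ (f i)) (hf : ∀ i, Differentiable ℝ (f i)) {z : E}
    (hz : ∑ i, ∇ (f i) z = 0) (x : E) (y : Fin n → E) :
    sumBregman f z (fun _ => x) ≤ ∑ i, ⟪sagaEstimator f x y i, x - z⟫ := by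
  rw [sumBregman_const hz, ← sum_inner, sum_sagaEstimator hn, sum_inner, ← Finset.sum_sub_distrib]
  refine Finset.sum_le_sum fun i _ => ?_
  have h := (hc i).add_inner_gradient_le (hf i) x z
  rw [← neg_sub x z, inner_neg_right] at h
  linarith

theorem sum_gradient_eq_zero_of_forall_le {f : Fin n → E → ℝ}
    (hf : ∀ i, Differentiable ℝ (f i)) {z : E} (hz : ∀ y, ∑ i, f i z ≤ ∑ i, f i y) :
    ∑ i, ∇ (f i) z = 0 := by
  have hd : HasFDerivAt (fun y => ∑ i, f i y)
      (∑ i, (InnerProductSpace.toDual ℝ E) (∇ (f i) z)) z :=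
    HasFDerivAt.fun_sum fun i _ => (hf i z).hasGradientAt.hasFDerivAt
  have h0 := IsLocalMin.hasFDerivAt_eq_zero (Filter.Eventually.of_forall hz) hd
  rw [← map_sum] at h0
  exact (map_eq_zero_iff _ (InnerProductSpace.toDual ℝ E).injective).1 h0

end SAGA

section AdaLVR

variable {n d : ℕ} {f : Fin n → EuclideanSpace ℝ (Fin d) → ℝ}
  {proj : EuclideanSpace ℝ (Fin d) → EuclideanSpace ℝ (Fin d)} {η : ℝ}
  {x1 : EuclideanSpace ℝ (Fin d)}

theorem adaLVRstate_succ (idx : ℕ → Fin n) (t : ℕ) :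
    adaLVRstate n d f proj η x1 idx (t + 1) =
      (proj ((adaLVRstate n d f proj η x1 idx t).1
        - (η / √((adaLVRstate n d f proj η x1 idx t).2.2
            + ‖sagaEstimator f (adaLVRstate n d f proj η x1 idx t).1
              (adaLVRstate n d f proj η x1 idx t).2.1 (idx (t + 1))‖ ^ 2))
          • sagaEstimator f (adaLVRstate n d f proj η x1 idx t).1
              (adaLVRstate n d f proj η x1 idx t).2.1 (idx (t + 1))),
      Function.update (adaLVRstate n d f proj η x1 idx t).2.1 (idx (t + 1))
        (adaLVRstate n d f proj η x1 idx t).1,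
      (adaLVRstate n d f proj η x1 idx t).2.2
        + ‖sagaEstimator f (adaLVRstate n d f proj η x1 idx t).1
            (adaLVRstate n d f proj η x1 idx t).2.1 (idx (t + 1))‖ ^ 2) :=
  rfl

/-- The state depends only on the indices already drawn. -/
theorem adaLVRstate_congr {idx idx' : ℕ → Fin n} {t : ℕ}
    (h : ∀ s, 1 ≤ s → s ≤ t → idx s = idx' s) :
    adaLVRstate n d f proj η x1 idx t = adaLVRstate n d f proj η x1 idx' t := by
  induction t with
  | zero => rfl
  | succ t ih =>
    have ih' := ih fun s h1 h2 => h s h1 (h2.trans t.le_succ)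
    have hi := h (t + 1) (Nat.le_add_left 1 t) le_rfl
    simp only [adaLVRstate, ih', hi]

theorem extIdx_succ {T : ℕ} (hT : 0 < T) (ω : Fin T → Fin n) (t : Fin T) :
    extIdx T hT ω (t + 1) = ω t := by
  simp [extIdx, Nat.mod_eq_of_lt t.isLt]

theorem adaLVRstate_extIdx_update {T : ℕ} (hT : 0 < T) (ω : Fin T → Fin n) (t : Fin T)
    (j : Fin n) :
    adaLVRstate n d f proj η x1 (extIdx T hT (Function.update ω t j)) t
      = adaLVRstate n d f proj η x1 (extIdx T hT ω) t := by
  refine adaLVRstate_congr fun s h1 h2 => ?_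
  have hs : s - 1 < T := by have := t.isLt; omega
  have : (⟨(s - 1) % T, Nat.mod_lt _ hT⟩ : Fin T) ≠ t := by
    intro h
    have h' := congrArg Fin.val h
    simp only [Nat.mod_eq_of_lt hs] at h'
    omega
  simp only [extIdx, Function.update_of_ne this]

/-- Conditionally on the past, the index drawn at step `t + 1` is uniform. -/
theorem mul_sum_adaLVRstate {T : ℕ} (hT : 0 < T) (t : Fin T)
    (Φ : EuclideanSpace ℝ (Fin d) × (Fin n → EuclideanSpace ℝ (Fin d)) × ℝ → Fin n → ℝ) :
    n * ∑ ω : Fin T → Fin n, Φ (adaLVRstate n d f proj η x1 (extIdx T hT ω) t) (ω t)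
      = ∑ ω : Fin T → Fin n, ∑ j, Φ (adaLVRstate n d f proj η x1 (extIdx T hT ω) t) j := by
  rw [← sum_sum_update t]
  simp only [adaLVRstate_extIdx_update, Function.update_self]

theorem adaLVRstate_grad_sum (idx : ℕ → Fin n) (k : ℕ) :
    (adaLVRstate n d f proj η x1 idx k).2.2
      = ∑ t ∈ Finset.range k, ‖sagaEstimator f (adaLVRstate n d f proj η x1 idx t).1
          (adaLVRstate n d f proj η x1 idx t).2.1 (idx (t + 1))‖ ^ 2 := by
  induction k with
  | zero => rfl
  | succ k ih => rw [Finset.sum_range_succ, ← ih, adaLVRstate_succ]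

variable {X : Set (EuclideanSpace ℝ (Fin d))}

theorem adaLVRstate_fst_mem (hproj : ∀ z, proj z ∈ X) (hx1 : x1 ∈ X) (idx : ℕ → Fin n) (t : ℕ) :
    (adaLVRstate n d f proj η x1 idx t).1 ∈ X := by
  cases t with
  | zero => exact hx1
  | succ t => exact hproj _

/-- Pathwise regret bound of AdaGrad-Norm. -/
theorem adaLVRstate_regret (hX : Convex ℝ X) (hη : 0 < η) {D : ℝ}
    (hdiam : ∀ x ∈ X, ∀ y ∈ X, ‖x - y‖ ≤ D)
    (hproj : ∀ z, proj z ∈ X ∧ ∀ y ∈ X, ‖proj z - z‖ ≤ ‖y - z‖) (hx1 : x1 ∈ X)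
    {z : EuclideanSpace ℝ (Fin d)} (hz : z ∈ X) (idx : ℕ → Fin n) (k : ℕ) :
    ∑ t ∈ Finset.range k, ⟪sagaEstimator f (adaLVRstate n d f proj η x1 idx t).1
          (adaLVRstate n d f proj η x1 idx t).2.1 (idx (t + 1)),
          (adaLVRstate n d f proj η x1 idx t).1 - z⟫
      ≤ (η + D ^ 2 / (2 * η)) * √(adaLVRstate n d f proj η x1 idx k).2.2 := by
  have hmem := adaLVRstate_fst_mem (f := f) (η := η) (fun z => (hproj z).1) hx1 idx
  suffices h : ∑ t ∈ Finset.range k, ⟪sagaEstimator f (adaLVRstate n d f proj η x1 idx t).1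
          (adaLVRstate n d f proj η x1 idx t).2.1 (idx (t + 1)),
          (adaLVRstate n d f proj η x1 idx t).1 - z⟫
        + √(adaLVRstate n d f proj η x1 idx k).2.2 / (2 * η)
          * ‖(adaLVRstate n d f proj η x1 idx k).1 - z‖ ^ 2
      ≤ (η + D ^ 2 / (2 * η)) * √(adaLVRstate n d f proj η x1 idx k).2.2 by
    refine le_trans (le_add_of_nonneg_right ?_) h
    positivity
  induction k with
  | zero => simp [adaLVRstate]
  | succ k ih =>
    have hG : 0 ≤ (adaLVRstate n d f proj η x1 idx k).2.2 := by
      rw [adaLVRstate_grad_sum]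
      positivity
    have hstep := adaGradNorm_step hX hη hG hz (hdiam _ (hmem k) _ hz)
      (g := sagaEstimator f (adaLVRstate n d f proj η x1 idx k).1
        (adaLVRstate n d f proj η x1 idx k).2.1 (idx (k + 1)))
      (hproj _).1 (hproj _).2
    rw [Finset.sum_range_succ]
    rw [adaLVRstate_succ]
    linarith

section Expectation

variable {T : ℕ} (hT : 0 < T)

/-- The memory potential decreases in expectation up to the current suboptimality gap. -/
theorem sum_sumBregman_memory_succ (z : EuclideanSpace ℝ (Fin d)) (t : Fin T) :
    n * ∑ ω : Fin T → Fin n,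
        sumBregman f z (adaLVRstate n d f proj η x1 (extIdx T hT ω) (t + 1)).2.1
      = (n - 1) * ∑ ω : Fin T → Fin n,
          sumBregman f z (adaLVRstate n d f proj η x1 (extIdx T hT ω) t).2.1
        + ∑ ω : Fin T → Fin n,
          sumBregman f z (fun _ => (adaLVRstate n d f proj η x1 (extIdx T hT ω) t).1) := by
  have h := mul_sum_adaLVRstate (f := f) (proj := proj) (η := η) (x1 := x1) hT t
    (fun s j => sumBregman f z (Function.update s.2.1 j s.1))
  simp only [sum_sumBregman_update, Finset.sum_add_distrib, ← Finset.mul_sum] at h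
  simp only [adaLVRstate_succ, extIdx_succ]
  exact h

theorem sum_range_sumBregman_memory_le (hc : ∀ i, ConvexOn ℝ Set.univ (f i))
    (hf : ∀ i, Differentiable ℝ (f i)) (z : EuclideanSpace ℝ (Fin d)) :
    ∑ t ∈ Finset.range T, ∑ ω : Fin T → Fin n,
        sumBregman f z (adaLVRstate n d f proj η x1 (extIdx T hT ω) t).2.1
      ≤ n * ((n : ℝ) ^ T * sumBregman f z (fun _ => x1))
        + ∑ t ∈ Finset.range T, ∑ ω : Fin T → Fin n,
          sumBregman f z (fun _ => (adaLVRstate n d f proj η x1 (extIdx T hT ω) t).1) := by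
  have key : ∀ k ≤ T, n * ∑ ω : Fin T → Fin n,
        sumBregman f z (adaLVRstate n d f proj η x1 (extIdx T hT ω) k).2.1
      + ∑ t ∈ Finset.range k, ∑ ω : Fin T → Fin n,
        sumBregman f z (adaLVRstate n d f proj η x1 (extIdx T hT ω) t).2.1
      = n * ((n : ℝ) ^ T * sumBregman f z (fun _ => x1))
        + ∑ t ∈ Finset.range k, ∑ ω : Fin T → Fin n,
          sumBregman f z (fun _ => (adaLVRstate n d f proj η x1 (extIdx T hT ω) t).1) := by
    intro k
    induction k with
    | zero => simp [adaLVRstate]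
    | succ k ih =>
      intro hk
      have hstep := sum_sumBregman_memory_succ (f := f) (proj := proj) (η := η) (x1 := x1) hT z
        ⟨k, hk⟩
      have := ih (Nat.le_of_succ_le hk)
      rw [Finset.sum_range_succ, Finset.sum_range_succ]
      simp only at hstep
      linarith
  have hnn : 0 ≤ n * ∑ ω : Fin T → Fin n,
      sumBregman f z (adaLVRstate n d f proj η x1 (extIdx T hT ω) T).2.1 :=
    mul_nonneg n.cast_nonneg (Finset.sum_nonneg fun ω _ => sumBregman_nonneg hc hf z _)
  linarith [key T le_rfl]

theorem mul_sum_grad_sum_le (hc : ∀ i, ConvexOn ℝ Set.univ (f i))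
    (hf : ∀ i, Differentiable ℝ (f i)) {L : ℝ} (hL0 : 0 < L)
    (hL : ∀ i x y, ‖∇ (f i) x - ∇ (f i) y‖ ≤ L * ‖x - y‖) {z : EuclideanSpace ℝ (Fin d)}
    (hz : ∑ i, ∇ (f i) z = 0) :
    n * ∑ ω : Fin T → Fin n, (adaLVRstate n d f proj η x1 (extIdx T hT ω) T).2.2
      ≤ 4 * L * (n * ((n : ℝ) ^ T * sumBregman f z (fun _ => x1)))
        + 8 * L * ∑ t ∈ Finset.range T, ∑ ω : Fin T → Fin n,
          sumBregman f z (fun _ => (adaLVRstate n d f proj η x1 (extIdx T hT ω) t).1) := by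
  have hmem := mul_le_mul_of_nonneg_left
    (sum_range_sumBregman_memory_le (proj := proj) (η := η) (x1 := x1) hT hc hf z)
    (by positivity : 0 ≤ 4 * L)
  have hstep : ∀ t ∈ Finset.range T, n * ∑ ω : Fin T → Fin n,
        ‖sagaEstimator f (adaLVRstate n d f proj η x1 (extIdx T hT ω) t).1
          (adaLVRstate n d f proj η x1 (extIdx T hT ω) t).2.1 (extIdx T hT ω (t + 1))‖ ^ 2
      ≤ 4 * L * ∑ ω : Fin T → Fin n,
          sumBregman f z (fun _ => (adaLVRstate n d f proj η x1 (extIdx T hT ω) t).1)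
        + 4 * L * ∑ ω : Fin T → Fin n,
          sumBregman f z (adaLVRstate n d f proj η x1 (extIdx T hT ω) t).2.1 := by
    intro t ht
    have h := mul_sum_adaLVRstate (f := f) (proj := proj) (η := η) (x1 := x1) hT
      ⟨t, Finset.mem_range.1 ht⟩ (fun s j => ‖sagaEstimator f s.1 s.2.1 j‖ ^ 2)
    simp only [← extIdx_succ hT] at h
    rw [h, Finset.mul_sum, Finset.mul_sum, ← Finset.sum_add_distrib]
    exact Finset.sum_le_sum fun ω _ => sum_norm_sagaEstimator_sq_le hc hf hL0 hL hz _ _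
  have hsum := Finset.sum_le_sum hstep
  rw [Finset.sum_add_distrib, ← Finset.mul_sum, ← Finset.mul_sum, ← Finset.mul_sum] at hsum
  simp only [adaLVRstate_grad_sum (n := n) (d := d) _ T]
  rw [Finset.sum_comm]
  linarith

theorem sum_sumBregman_le_mul_sum_inner (hn : n ≠ 0) (hc : ∀ i, ConvexOn ℝ Set.univ (f i))
    (hf : ∀ i, Differentiable ℝ (f i)) {z : EuclideanSpace ℝ (Fin d)}
    (hz : ∑ i, ∇ (f i) z = 0) :
    ∑ t ∈ Finset.range T, ∑ ω : Fin T → Fin n,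
        sumBregman f z (fun _ => (adaLVRstate n d f proj η x1 (extIdx T hT ω) t).1)
      ≤ n * ∑ ω : Fin T → Fin n, ∑ t ∈ Finset.range T,
        ⟪sagaEstimator f (adaLVRstate n d f proj η x1 (extIdx T hT ω) t).1
          (adaLVRstate n d f proj η x1 (extIdx T hT ω) t).2.1 (extIdx T hT ω (t + 1)),
          (adaLVRstate n d f proj η x1 (extIdx T hT ω) t).1 - z⟫ := by
  rw [Finset.sum_comm (s := Finset.univ), Finset.mul_sum]
  refine Finset.sum_le_sum fun t ht => ?_
  have h := mul_sum_adaLVRstate (f := f) (proj := proj) (η := η) (x1 := x1) hT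
    ⟨t, Finset.mem_range.1 ht⟩ (fun s j => ⟪sagaEstimator f s.1 s.2.1 j, s.1 - z⟫)
  simp only [← extIdx_succ hT] at h
  rw [h]
  exact Finset.sum_le_sum fun ω _ => sumBregman_const_le_inner hn hc hf hz _ _

end Expectation

end AdaLVR

/-- Solving the self-bounding inequality `s ≤ c √(b s + a)`. -/
theorem le_of_le_mul_sqrt {s a b c : ℝ} (ha : 0 ≤ a) (hb : 0 ≤ b) (hc : 0 ≤ c) (hs : 0 ≤ s)
    (h : s ≤ c * √(b * s + a)) : s ≤ c * √a + b * c ^ 2 := by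
  by_contra! hlt
  have h2 : s ^ 2 ≤ c ^ 2 * (b * s + a) := by
    calc s ^ 2 ≤ (c * √(b * s + a)) ^ 2 := by gcongr
      _ = _ := by rw [mul_pow, Real.sq_sqrt (by positivity)]
  have hu : 0 ≤ c * √a := by positivity
  have hu2 : (c * √a) ^ 2 = c ^ 2 * a := by rw [mul_pow, Real.sq_sqrt ha]
  have hv : 0 ≤ b * c ^ 2 := by positivity
  nlinarith [mul_nonneg hs hu]

theorem sum_sqrt_le_sqrt_card_mul_sum {ι : Type*} [Fintype ι] {g : ι → ℝ} (hg : ∀ i, 0 ≤ g i) :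
    ∑ i, √(g i) ≤ √(Fintype.card ι * ∑ i, g i) := by
  refine Real.le_sqrt_of_sq_le ?_
  refine (sq_sum_le_card_mul_sum_sq (s := Finset.univ) (f := fun i => √(g i))).trans_eq ?_
  simp only [Real.sq_sqrt (hg _), Finset.card_univ]

theorem ConvexOn.map_inv_smul_sum_range_le {E : Type*} [AddCommGroup E] [Module ℝ E] {F : E → ℝ}
    (hF : ConvexOn ℝ Set.univ F) {T : ℕ} (hT : 0 < T) (x : ℕ → E) :
    F ((T : ℝ)⁻¹ • ∑ t ∈ Finset.range T, x t) ≤ (T : ℝ)⁻¹ * ∑ t ∈ Finset.range T, F (x t) := by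
  have hT' : (T : ℝ) ≠ 0 := by positivity
  have h := hF.map_sum_le (t := Finset.range T) (w := fun _ => (T : ℝ)⁻¹) (p := x)
    (fun _ _ => by positivity) (by simp [hT']) (fun _ _ => Set.mem_univ _)
  simpa [← Finset.smul_sum, ← Finset.mul_sum] using h

theorem stmt_19 (n d T : ℕ) (hn : 1 ≤ n) (hd : 1 ≤ d) (hT : 0 < T)
    (L η D : ℝ) (hL : 0 < L) (hη : 0 < η)
    (f : Fin n → EuclideanSpace ℝ (Fin d) → ℝ)
    (hconv : ∀ i, ConvexOn ℝ Set.univ (f i))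
    (hdiff : ∀ i, Differentiable ℝ (f i))
    (hsmooth : ∀ i x y, ‖gradient (f i) x - gradient (f i) y‖ ≤ L * ‖x - y‖)
    (F : EuclideanSpace ℝ (Fin d) → ℝ)
    (hF : F = fun x => (n : ℝ)⁻¹ * ∑ i, f i x)
    (X : Set (EuclideanSpace ℝ (Fin d))) (hXne : X.Nonempty)
    (hXcomp : IsCompact X) (hXconv : Convex ℝ X)
    (hdiam : ∀ x ∈ X, ∀ y ∈ X, ‖x - y‖ ≤ D)
    (xstar : EuclideanSpace ℝ (Fin d)) (hxstar : xstar ∈ X)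
    (hmin : ∀ y, F xstar ≤ F y)
    (proj : EuclideanSpace ℝ (Fin d) → EuclideanSpace ℝ (Fin d))
    (hproj : ∀ z, proj z ∈ X ∧ ∀ y ∈ X, ‖proj z - z‖ ≤ ‖y - z‖)
    (x1 : EuclideanSpace ℝ (Fin d)) (hx1 : x1 ∈ X) :
    (∑ ω : Fin T → Fin n,
        F ((T : ℝ)⁻¹ • ∑ t ∈ Finset.Icc 1 T,
            adaLVRx n d f proj η x1 (extIdx T hT ω) t)) / (n : ℝ) ^ T
      - F xstar
      ≤ ((η + D ^ 2 / (2 * η)) * Real.sqrt (4 * L * n * (F x1 - F xstar))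
          + 8 * L * (η + D ^ 2 / (2 * η)) ^ 2) / T := by
  have hn0 : n ≠ 0 := by omega
  have hnR : (0 : ℝ) < n := by exact_mod_cast hn
  have hTR : (0 : ℝ) < T := by exact_mod_cast hT
  have hN : (0 : ℝ) < (n : ℝ) ^ T := by positivity
  have hcard : (Fintype.card (Fin T → Fin n) : ℝ) = (n : ℝ) ^ T := by simp
  have hz : ∑ i, gradient (f i) xstar = 0 := by
    refine sum_gradient_eq_zero_of_forall_le hdiff fun y => ?_
    have := hmin y
    rw [hF] at this
    exact le_of_mul_le_mul_left this (by positivity)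
  have hB : ∀ x, sumBregman f xstar (fun _ => x) = n * (F x - F xstar) := by
    intro x
    rw [sumBregman_const hz, hF]
    field_simp
  have hFconv : ConvexOn ℝ Set.univ F := by
    rw [hF]
    have hs : ConvexOn ℝ Set.univ (∑ i, f i) :=
      Finset.sum_induction f (ConvexOn ℝ Set.univ) (fun _ _ => ConvexOn.add)
        (convexOn_const 0 convex_univ) fun i _ => hconv i
    have := hs.smul (inv_nonneg.2 hnR.le)
    simpa using this
  set c := η + D ^ 2 / (2 * η) with hc
  have hc0 : 0 ≤ c := by positivity
  set st := fun (ω : Fin T → Fin n) (t : ℕ) => adaLVRstate n d f proj η x1 (extIdx T hT ω) t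
  set gap := ∑ t ∈ Finset.range T, ∑ ω : Fin T → Fin n, (F (st ω t).1 - F xstar) with hgap
  have hgapB : ∑ t ∈ Finset.range T, ∑ ω : Fin T → Fin n,
      sumBregman f xstar (fun _ => (st ω t).1) = n * gap := by
    simp only [hB, hgap, Finset.mul_sum]
  have hgap0 : 0 ≤ gap :=
    Finset.sum_nonneg fun t _ => Finset.sum_nonneg fun ω _ => sub_nonneg.2 (hmin _)
  have hQ := mul_sum_grad_sum_le (proj := proj) (η := η) (x1 := x1) hT hconv hdiff hL hsmooth hz
  have hP := sum_sumBregman_le_mul_sum_inner (proj := proj) (η := η) (x1 := x1) hT hn0 hconv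
    hdiff hz
  rw [hgapB] at hQ hP
  rw [hB] at hQ
  set Q := ∑ ω : Fin T → Fin n, (st ω T).2.2 with hQdef
  have hG : ∀ ω, 0 ≤ (st ω T).2.2 := fun ω => by
    simp only [st, adaLVRstate_grad_sum]
    positivity
  have hgap1 : gap ≤ c * √((n : ℝ) ^ T * Q) := by
    calc gap ≤ _ := le_of_mul_le_mul_left hP hnR
      _ ≤ ∑ ω : Fin T → Fin n, c * √((st ω T).2.2) := Finset.sum_le_sum fun ω _ =>
          adaLVRstate_regret hXconv hη hdiam hproj hx1 hxstar _ T
      _ ≤ c * √((n : ℝ) ^ T * Q) := by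
          rw [← Finset.mul_sum, ← hcard]
          exact mul_le_mul_of_nonneg_left (sum_sqrt_le_sqrt_card_mul_sum hG) hc0
  have hself : gap / (n : ℝ) ^ T
      ≤ c * √(8 * L * (gap / (n : ℝ) ^ T) + 4 * L * n * (F x1 - F xstar)) := by
    have hQ' : Q / (n : ℝ) ^ T
        ≤ 8 * L * (gap / (n : ℝ) ^ T) + 4 * L * n * (F x1 - F xstar) := by
      rw [div_le_iff₀ hN]
      refine le_of_mul_le_mul_left (hQ.trans_eq ?_) hnR
      field_simp
      ring
    calc gap / (n : ℝ) ^ T ≤ c * √((n : ℝ) ^ T * Q) / (n : ℝ) ^ T := by gcongr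
      _ = c * √(Q / (n : ℝ) ^ T) := by
          rw [show (n : ℝ) ^ T * Q = ((n : ℝ) ^ T) ^ 2 * (Q / (n : ℝ) ^ T) by field_simp,
            Real.sqrt_mul (by positivity), Real.sqrt_sq hN.le]
          field_simp
      _ ≤ _ := by gcongr
  have hfinal := le_of_le_mul_sqrt
    (mul_nonneg (by positivity) (sub_nonneg.2 (hmin x1))) (by positivity) hc0
    (by positivity) hself
  have havg : ∀ ω : Fin T → Fin n, F ((T : ℝ)⁻¹ • ∑ t ∈ Finset.Icc 1 T,
      adaLVRx n d f proj η x1 (extIdx T hT ω) t)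
      ≤ F xstar + (T : ℝ)⁻¹ * ∑ t ∈ Finset.range T, (F (st ω t).1 - F xstar) := by
    intro ω
    have hsum : ∑ t ∈ Finset.Icc 1 T, adaLVRx n d f proj η x1 (extIdx T hT ω) t
        = ∑ t ∈ Finset.range T, (st ω t).1 := by
      rw [Finset.range_eq_Ico, ← Finset.Ico_succ_right_eq_Icc, Finset.sum_Ico_eq_sum_range]
      simp [adaLVRx, st]
    rw [hsum]
    refine (hFconv.map_inv_smul_sum_range_le hT _).trans_eq ?_
    rw [Finset.sum_sub_distrib]
    simp only [Finset.sum_const, Finset.card_range, nsmul_eq_mul]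
    field_simp
    ring
  have hsumavg := Finset.sum_le_sum fun ω (_ : ω ∈ Finset.univ) => havg ω
  rw [Finset.sum_add_distrib, ← Finset.mul_sum, Finset.sum_comm, ← hgap, Finset.sum_const,
    Finset.card_univ, nsmul_eq_mul, hcard] at hsumavg
  calc _ ≤ ((n : ℝ) ^ T * F xstar + (T : ℝ)⁻¹ * gap) / (n : ℝ) ^ T - F xstar := by gcongr
    _ = gap / (n : ℝ) ^ T / T := by
        field_simp
        ring
    _ ≤ _ := by gcongr
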